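/- Let A ⊆ ℝ be closed, nowhere dense, and of positive Lebesgue measure, and let E be the set of right endpoints of the bounded connected components of ℝ∖A. Then the closure of the difference set {x − y : x, y ∈ E} has nonempty interior. -/

import Mathlib

open Set

/-- For a closed set `A ⊆ ℝ`, `Ioo u v` is a bounded connected component of `ℝ \ A`
(a bounded complementary interval of `A`) iff `u < v`, `Ioo u v` misses `A`, and
both endpoints belong to `A`. -/
def IsBddCompInterval (A : Set ℝ) (u v : ℝ) : Prop :=
  u < v ∧ Ioo u v ∩ A = ∅ ∧ u ∈ A ∧ v ∈ A

/-- The set of right endpoints of bounded complementary intervals of `A`. -/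
def rightEndpoints (A : Set ℝ) : Set ℝ :=
  {v | ∃ u, IsBddCompInterval A u v}

theorem exists_mem_rightEndpoints_Ioc {A : Set ℝ} (hcl : IsClosed A) (hint : interior A = ∅)
    {a b : ℝ} (ha : a ∈ A) (hb : b ∈ A) (hab : a < b) :
    ∃ v ∈ rightEndpoints A, v ∈ Ioc a b := by
  obtain ⟨c, hc, hcA⟩ : ∃ c ∈ Ioo a b, c ∉ A := by
    by_contra! h
    have h' : Ioo a b ⊆ interior A := interior_maximal h isOpen_Ioo
    rw [hint, subset_empty_iff, Ioo_eq_empty_iff] at h'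
    exact h' hab
  obtain ⟨u, ⟨huA, hu⟩, hu'⟩ := (isCompact_Icc.inter_left hcl).exists_isGreatest
    (s := A ∩ Icc a c) ⟨a, ha, le_rfl, hc.1.le⟩
  obtain ⟨v, ⟨hvA, hv⟩, hv'⟩ := (isCompact_Icc.inter_left hcl).exists_isLeast
    (s := A ∩ Icc c b) ⟨b, hb, hc.2.le, le_rfl⟩
  have huc : u < c := hu.2.lt_of_ne (by rintro rfl; exact hcA huA)
  have hcv : c < v := hv.1.lt_of_ne (by rintro rfl; exact hcA hvA)
  refine ⟨v, ⟨u, huc.trans hcv, ?_, huA, hvA⟩, hc.1.trans hcv, hv.2⟩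
  rw [eq_empty_iff_forall_notMem]
  rintro x ⟨⟨hux, hxv⟩, hxA⟩
  rcases le_total x c with h | h
  · exact hux.not_ge (hu' ⟨hxA, hu.1.trans hux.le, h⟩)
  · exact hxv.not_ge (hv' ⟨hxA, h, hxv.le.trans hv.2⟩)

theorem volume_diff_closure_rightEndpoints {A : Set ℝ} (hcl : IsClosed A)
    (hint : interior A = ∅) :
    MeasureTheory.volume (A \ closure (rightEndpoints A)) = 0 := by
  refine MeasureTheory.measure_null_of_locally_null _ fun x hx => ?_
  obtain ⟨ε, hε, hball⟩ := Metric.isOpen_iff.1 isClosed_closure.isOpen_compl x hx.2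
  refine ⟨_, inter_mem_nhdsWithin _ (Metric.ball_mem_nhds x hε), ?_⟩
  refine Set.Subsingleton.measure_zero (fun a ha b hb => ?_) _
  have key : ∀ a ∈ A ∩ Metric.ball x ε, ∀ b ∈ A ∩ Metric.ball x ε, ¬ a < b := by
    rintro a ⟨ha, hax⟩ b ⟨hb, hbx⟩ hab
    obtain ⟨v, hv, hvI⟩ := exists_mem_rightEndpoints_Ioc hcl hint ha hb hab
    rw [Real.ball_eq_Ioo] at hax hbx hball
    exact hball ⟨hax.1.trans hvI.1, hvI.2.trans_lt hbx.2⟩ (subset_closure hv)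
  have ha' := And.intro ha.1.1 ha.2
  have hb' := And.intro hb.1.1 hb.2
  exact le_antisymm (not_lt.1 (key b hb' a ha')) (not_lt.1 (key a ha' b hb'))

theorem stmt13 (A : Set ℝ) (hcl : IsClosed A)
    (hnd : interior (closure A) = ∅)
    (hpos : 0 < MeasureTheory.volume A) :
    (interior (closure
      {x | ∃ a ∈ rightEndpoints A, ∃ b ∈ rightEndpoints A, x = a - b})).Nonempty := by
  rw [hcl.closure_eq] at hnd
  have hE : 0 < MeasureTheory.volume (closure (rightEndpoints A)) :=
    hpos.trans_le (MeasureTheory.measure_mono_ae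
      (MeasureTheory.ae_le_set.2 (volume_diff_closure_rightEndpoints hcl hnd)))
  have h0 := MeasureTheory.Measure.sub_mem_nhds_zero_of_addHaar_pos MeasureTheory.volume
    (closure (rightEndpoints A)) isClosed_closure.measurableSet hE
  refine ⟨0, mem_interior_iff_mem_nhds.2 (Filter.mem_of_superset h0 ?_)⟩
  rintro _ ⟨a, ha, b, hb, rfl⟩
  exact map_mem_closure₂ continuous_sub ha hb fun a ha b hb => ⟨a, ha, b, hb, rfl⟩
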